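/- arXiv:1512.02364 — 5 statements merged into one kernel-verified Lean document; each statement's English description precedes it below -/
import Mathlib

section
/- Let $c \ge 0$ and $n > c$ be real numbers. Then the Tsallis entropy of order 2, $T_{n,c}(x) := 1 - S_{n,c}(x)$, is concave and increasing on $[0,+\infty)$. Moreover, $u = T_{n,c}$ is a solution on $(0,+\infty)$ of the differential equation $x(1+cx)(1+2cx)\,u''(x) + \left(4(n+c)x(1+cx)+1\right)u'(x) + 2n(1+2cx)\,u(x) = 2n(1+2cx)$. -/
/-- Generalized binomial coefficient `α(α-1)⋯(α-k+1)/k!`. -/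
noncomputable def genBinom (α : ℝ) (k : ℕ) : ℝ :=
  (∏ i ∈ Finset.range k, (α - i)) / (Nat.factorial k)

/-- The basic probabilities `p_{n,k}^{[c]}(x)` for `c ≥ 0`. -/
noncomputable def pc (c n : ℝ) (k : ℕ) (x : ℝ) : ℝ :=
  if c = 0 then (n * x) ^ k / (Nat.factorial k) * Real.exp (-(n * x))
  else (-1 : ℝ) ^ k * genBinom (-n / c) k * (c * x) ^ k
    * (1 + c * x) ^ (-n / c - (k : ℝ))

/-- `S_{n,c}(x) = ∑_{k=0}^∞ (p_{n,k}^{[c]}(x))²`. -/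
noncomputable def Sc (c n : ℝ) (x : ℝ) : ℝ :=
  ∑' k : ℕ, (pc c n k x) ^ 2

/-- The Tsallis entropy of order 2: `T_{n,c}(x) = 1 - S_{n,c}(x)`. -/
noncomputable def Tc (c n : ℝ) (x : ℝ) : ℝ := 1 - Sc c n x

open Filter Topology

/-- The sum of the power series with coefficients `b`. -/
noncomputable def powSum (b : ℕ → ℝ) (q : ℝ) : ℝ := ∑' k, b k * q ^ k

/-- The coefficients of the formal derivative of a power series. -/
def derivCoeff (b : ℕ → ℝ) (k : ℕ) : ℝ := (k + 1) * b (k + 1)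

/-- Positive coefficients whose successive ratios converge to `L`. -/
structure RatioSeq (b : ℕ → ℝ) (L : ℝ) : Prop where
  pos : ∀ k, 0 < b k
  tendsto : Tendsto (fun k => b (k + 1) / b k) atTop (𝓝 L)

namespace RatioSeq

variable {b : ℕ → ℝ} {L q : ℝ}

theorem derivCoeff (h : RatioSeq b L) : RatioSeq (derivCoeff b) L where
  pos k := mul_pos (by positivity) (h.pos _)
  tendsto := by
    have h1 : Tendsto (fun k : ℕ => 1 + 1 / ((k : ℝ) + 1)) atTop (𝓝 (1 + 0)) :=
      tendsto_const_nhds.add tendsto_one_div_add_atTop_nhds_zero_nat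
    have h2 := h1.mul (h.tendsto.comp (tendsto_add_atTop_nat 1))
    simp only [add_zero, one_mul] at h2
    refine h2.congr fun k => ?_
    have := (h.pos (k + 1)).ne'
    simp only [_root_.derivCoeff, Function.comp]
    push_cast
    field_simp

theorem summable (h : RatioSeq b L) (hq : L * |q| < 1) : Summable fun k => b k * q ^ k := by
  rcases eq_or_ne q 0 with rfl | hq0
  · exact summable_of_ne_finset_zero (s := {0}) fun k hk => by
      simp [Finset.notMem_singleton.1 hk]
  refine summable_of_ratio_test_tendsto_lt_one hq
    (Eventually.of_forall fun k => mul_ne_zero (h.pos k).ne' (pow_ne_zero _ hq0)) ?_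
  refine (h.tendsto.mul_const |q|).congr fun k => ?_
  have := (h.pos k).ne'
  have := abs_pos.2 hq0
  simp only [norm_mul, norm_pow, Real.norm_eq_abs, abs_of_pos (h.pos _)]
  field_simp
  ring

theorem hasDerivAt (h : RatioSeq b L) (hq : L * |q| < 1) :
    HasDerivAt (powSum b) (powSum (_root_.derivCoeff b) q) q := by
  obtain ⟨R, hqR, hR⟩ : ∃ R, |q| < R ∧ L * R < 1 := by
    have hc : Tendsto (fun R => L * R) (𝓝[>] |q|) (𝓝 (L * |q|)) :=
      (continuous_const.mul continuous_id).continuousWithinAt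
    obtain ⟨R, h1, h2⟩ := ((hc.eventually (gt_mem_nhds hq)).and self_mem_nhdsWithin).exists
    exact ⟨R, h2, h1⟩
  have hR0 : 0 < R := (abs_nonneg q).trans_lt hqR
  have hs : Summable fun k : ℕ => b k * (k * R ^ (k - 1)) := by
    rw [← summable_nat_add_iff 1]
    refine (h.derivCoeff.summable (q := R) (by rwa [abs_of_pos hR0])).congr fun k => ?_
    simp only [_root_.derivCoeff, add_tsub_cancel_right]
    push_cast
    ring
  have key := hasDerivAt_tsum_of_isPreconnected (g := fun k z => b k * z ^ k)
    (g' := fun k z => b k * (k * z ^ (k - 1))) (y₀ := q) (y := q) hs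
    (Metric.isOpen_ball (x := (0 : ℝ)) (ε := R)) (convex_ball 0 R).isPreconnected
    (fun k z _ => (hasDerivAt_pow k z).const_mul (b k))
    (fun k z hz => by
      rw [mem_ball_zero_iff, Real.norm_eq_abs] at hz
      simp only [norm_mul, norm_pow, Real.norm_eq_abs, abs_of_pos (h.pos k), Nat.abs_cast]
      have := (h.pos k).le
      gcongr)
    (by simpa using hqR) (h.summable hq) (by simpa using hqR)
  have hs' : Summable fun k : ℕ => b k * (k * q ^ (k - 1)) := by
    refine Summable.of_norm_bounded hs fun k => ?_
    simp only [norm_mul, norm_pow, Real.norm_eq_abs, abs_of_pos (h.pos k), Nat.abs_cast]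
    have := (h.pos k).le
    gcongr
  refine key.congr_deriv ?_
  rw [hs'.tsum_eq_zero_add]
  simp only [powSum, _root_.derivCoeff, Nat.cast_zero, zero_mul, mul_zero, zero_add,
    add_tsub_cancel_right]
  refine tsum_congr fun k => ?_
  push_cast
  ring

theorem hasSum (h : RatioSeq b L) (hq : L * |q| < 1) :
    HasSum (fun k => b k * q ^ k) (powSum b q) := (h.summable hq).hasSum

theorem powSum_pos (h : RatioSeq b L) (hq : L * |q| < 1) (hq0 : 0 ≤ q) : 0 < powSum b q :=
  (h.summable hq).tsum_pos (fun k => mul_nonneg (h.pos k).le (pow_nonneg hq0 k)) 0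
    (by simpa using h.pos 0)

end RatioSeq

theorem hasSum_mul_of_shift {a : ℕ → ℝ} {q s : ℝ} (h : HasSum (fun k => a (k + 1) * q ^ k) s)
    (h0 : a 0 = 0) : HasSum (fun k => a k * q ^ k) (q * s) := by
  rw [← hasSum_nat_add_iff' 1]
  simp only [Finset.range_one, Finset.sum_singleton, h0, zero_mul, sub_zero]
  refine (h.mul_left q).congr_fun ?_
  intro k
  ring

/-- The coefficients `(∏_{i<k} (n + c i) / k!)²`. -/
noncomputable def sqCoeff (c n : ℝ) (k : ℕ) : ℝ :=
  ((∏ i ∈ Finset.range k, (n + c * i)) / k.factorial) ^ 2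

theorem sqCoeff_succ (c n : ℝ) (k : ℕ) :
    ((k : ℝ) + 1) ^ 2 * sqCoeff c n (k + 1) = (n + c * k) ^ 2 * sqCoeff c n k := by
  have : (k.factorial : ℝ) ≠ 0 := by positivity
  simp only [sqCoeff, Finset.prod_range_succ, Nat.factorial_succ]
  push_cast
  field_simp

theorem ratioSeq_sqCoeff {c n : ℝ} (hc : 0 ≤ c) (hn : 0 < n) :
    RatioSeq (sqCoeff c n) (c ^ 2) where
  pos k := by
    have : 0 < ∏ i ∈ Finset.range k, (n + c * i) := Finset.prod_pos fun i _ => by positivity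
    unfold sqCoeff
    positivity
  tendsto := by
    have h1 : Tendsto (fun k : ℕ => (c + (n - c) * (1 / ((k : ℝ) + 1))) ^ 2) atTop
        (𝓝 ((c + (n - c) * 0) ^ 2)) :=
      ((tendsto_one_div_add_atTop_nhds_zero_nat.const_mul _).const_add _).pow 2
    rw [mul_zero, add_zero] at h1
    refine h1.congr fun k => ?_
    have hp : 0 < ∏ i ∈ Finset.range k, (n + c * i) := Finset.prod_pos fun i _ => by positivity
    have hk : sqCoeff c n k ≠ 0 := by
      unfold sqCoeff
      positivity
    have hs : sqCoeff c n (k + 1) = (n + c * k) ^ 2 * sqCoeff c n k / ((k : ℝ) + 1) ^ 2 := by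
      rw [← sqCoeff_succ]
      field_simp
    rw [hs]
    field_simp
    ring

/-- The hypergeometric differential equation. -/
theorem powSum_sqCoeff_ode {c n q : ℝ} (hc : 0 ≤ c) (hn : 0 < n) (hq : c ^ 2 * |q| < 1) :
    q * powSum (derivCoeff (derivCoeff (sqCoeff c n))) q + powSum (derivCoeff (sqCoeff c n)) q =
      n ^ 2 * powSum (sqCoeff c n) q
        + (2 * n * c + c ^ 2) * (q * powSum (derivCoeff (sqCoeff c n)) q)
        + c ^ 2 * (q * (q * powSum (derivCoeff (derivCoeff (sqCoeff c n))) q)) := by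
  have hb := ratioSeq_sqCoeff hc hn
  have h0 := hb.hasSum hq
  have h1 := hb.derivCoeff.hasSum hq
  have h2 := hb.derivCoeff.derivCoeff.hasSum hq
  have e1 := hasSum_mul_of_shift (a := fun k => k * sqCoeff c n k)
    (by simpa [derivCoeff] using h1) (by simp)
  have e2 := hasSum_mul_of_shift (a := fun k => k * derivCoeff (sqCoeff c n) k)
    (by simpa [derivCoeff] using h2) (by simp)
  have e3 := hasSum_mul_of_shift (a := fun k => k * ((k : ℝ) - 1) * sqCoeff c n k)
    (e2.congr_fun fun k => by simp only [derivCoeff]; push_cast; ring) (by simp)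
  refine (e2.add h1).unique
    ((((h0.mul_left (n ^ 2)).add (e1.mul_left (2 * n * c + c ^ 2))).add
      (e3.mul_left (c ^ 2))).congr_fun fun k => ?_)
  have := sqCoeff_succ c n k
  simp only [derivCoeff]
  linear_combination q ^ k * this

/-- The factor `(1 + c x) ^ (-2 n / c)`, with its limit `exp (-2 n x)` for `c = 0`. -/
noncomputable def weight (c n x : ℝ) : ℝ :=
  if c = 0 then Real.exp (-(2 * n * x)) else (1 + c * x) ^ (2 * (-n / c))

theorem weight_pos {c x : ℝ} (n : ℝ) (hx : 0 < 1 + c * x) : 0 < weight c n x := by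
  unfold weight
  split_ifs <;> positivity

theorem hasDerivAt_weight {c x : ℝ} (n : ℝ) (hx : 0 < 1 + c * x) :
    HasDerivAt (weight c n) (-2 * n * (1 + c * x)⁻¹ * weight c n x) x := by
  by_cases hc : c = 0
  · subst hc
    have h : HasDerivAt (fun y => Real.exp (-(2 * n * y))) _ x :=
      (((hasDerivAt_id' x).const_mul (2 * n)).neg).exp
    have hw : weight 0 n = fun y => Real.exp (-(2 * n * y)) := by
      funext y
      simp [weight]
    rw [hw]
    refine h.congr_deriv ?_
    simp
    ring
  · have h : HasDerivAt (fun y => (1 + c * y) ^ (2 * (-n / c))) _ x :=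
      (((hasDerivAt_id' x).const_mul c).const_add 1).rpow_const (Or.inl hx.ne')
    have hw : weight c n = fun y => (1 + c * y) ^ (2 * (-n / c)) := by
      funext y
      simp [weight, hc]
    rw [hw]
    refine h.congr_deriv ?_
    rw [Real.rpow_sub_one hx.ne']
    field_simp

theorem sq_pc {c n x : ℝ} (hx : 0 < 1 + c * x) (k : ℕ) :
    pc c n k x ^ 2 = weight c n x * (sqCoeff c n k * (x ^ 2 * (1 + c * x)⁻¹ ^ 2) ^ k) := by
  by_cases hc : c = 0
  · subst hc
    have : Real.exp (-(2 * n * x)) = Real.exp (-(n * x)) ^ 2 := by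
      rw [← Real.exp_nat_mul]
      congr 1
      push_cast
      ring
    simp only [pc, weight, sqCoeff, if_true, this]
    simp
    ring
  · have h1 : (1 + c * x) ^ (2 * (-n / c)) = ((1 + c * x) ^ (-n / c)) ^ 2 := by
      rw [mul_comm 2, Real.rpow_mul hx.le]
      norm_cast
    have h2 : (-1 : ℝ) ^ k * (∏ i ∈ Finset.range k, (-n / c - i)) * c ^ k =
        ∏ i ∈ Finset.range k, (n + c * i) := by
      have h3 : ∀ a : ℝ, a ^ k = ∏ _i ∈ Finset.range k, a := fun a => by simp
      rw [h3, h3, ← Finset.prod_mul_distrib, ← Finset.prod_mul_distrib]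
      refine Finset.prod_congr rfl fun i _ => ?_
      field_simp
      ring
    simp only [pc, weight, sqCoeff, genBinom, if_neg hc, h1, ← h2, Real.rpow_sub hx,
      Real.rpow_natCast]
    generalize ∏ i ∈ Finset.range k, (-n / c - i) = P
    generalize 1 + c * x = w at hx
    ring

theorem one_add_pos {c x : ℝ} (hx : 0 < 1 + 2 * c * x) : 0 < 1 + c * x := by linarith

theorem mul_abs_sq_lt_one {c x : ℝ} (hx : 0 < 1 + 2 * c * x) :
    c ^ 2 * |x ^ 2 * (1 + c * x)⁻¹ ^ 2| < 1 := by
  have := one_add_pos hx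
  rw [abs_of_nonneg (by positivity), inv_pow, ← mul_assoc, ← div_eq_mul_inv,
    div_lt_one (by positivity)]
  linarith

/-- The composition of a power series with `x ↦ (x / (1 + c x))²`. -/
noncomputable def sqSum (b : ℕ → ℝ) (c x : ℝ) : ℝ := powSum b (x ^ 2 * (1 + c * x)⁻¹ ^ 2)

theorem hasDerivAt_inv_one_add {c x : ℝ} (hx : 0 < 1 + c * x) :
    HasDerivAt (fun y => (1 + c * y)⁻¹) (-c * (1 + c * x)⁻¹ ^ 2) x := by
  have h : HasDerivAt (fun y => (1 + c * y)⁻¹) _ x :=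
    (((hasDerivAt_id' x).const_mul c).const_add 1).inv hx.ne'
  refine h.congr_deriv ?_
  field_simp

theorem hasDerivAt_sqSum {b : ℕ → ℝ} {c x : ℝ} (hb : RatioSeq b (c ^ 2))
    (hx : 0 < 1 + 2 * c * x) :
    HasDerivAt (sqSum b c) (2 * x * (1 + c * x)⁻¹ ^ 3 * sqSum (derivCoeff b) c x) x := by
  have h1 := one_add_pos hx
  have h : HasDerivAt (fun y => powSum b (y ^ 2 * (1 + c * y)⁻¹ ^ 2)) _ x :=
    HasDerivAt.comp (h₂ := powSum b) x (hb.hasDerivAt (mul_abs_sq_lt_one hx))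
      (((hasDerivAt_id' x).fun_pow 2).fun_mul ((hasDerivAt_inv_one_add h1).fun_pow 2))
  refine h.congr_deriv ?_
  simp only [sqSum, Nat.cast_ofNat, Nat.add_one_sub_one]
  field_simp
  ring

/-- An explicit expression for the first derivative of `Sc`. -/
noncomputable def ScDeriv (c n x : ℝ) : ℝ :=
  weight c n x * (-2 * n * (1 + c * x)⁻¹ * sqSum (sqCoeff c n) c x
    + 2 * x * (1 + c * x)⁻¹ ^ 3 * sqSum (derivCoeff (sqCoeff c n)) c x)

/-- An explicit expression for the second derivative of `Sc`. -/
noncomputable def ScDeriv2 (c n x : ℝ) : ℝ :=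
  weight c n x * ((4 * n ^ 2 + 2 * n * c) * (1 + c * x)⁻¹ ^ 2 * sqSum (sqCoeff c n) c x
    + (2 * (1 + c * x)⁻¹ ^ 3 - (8 * n + 6 * c) * x * (1 + c * x)⁻¹ ^ 4)
      * sqSum (derivCoeff (sqCoeff c n)) c x
    + 4 * x ^ 2 * (1 + c * x)⁻¹ ^ 6 * sqSum (derivCoeff (derivCoeff (sqCoeff c n))) c x)

section

variable {c n x : ℝ}

theorem Sc_eq (hx : 0 < 1 + 2 * c * x) :
    Sc c n x = weight c n x * sqSum (sqCoeff c n) c x := by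
  simp only [Sc, sq_pc (one_add_pos hx), tsum_mul_left, sqSum, powSum]

theorem eventually_pos (hx : 0 < 1 + 2 * c * x) : ∀ᶠ y in 𝓝 x, 0 < 1 + 2 * c * y :=
  continuousAt_const.eventually_lt (by fun_prop) hx

theorem hasDerivAt_Sc (hc : 0 ≤ c) (hn : 0 < n) (hx : 0 < 1 + 2 * c * x) :
    HasDerivAt (Sc c n) (ScDeriv c n x) x := by
  have h := (hasDerivAt_weight n (one_add_pos hx)).mul
    (hasDerivAt_sqSum (ratioSeq_sqCoeff hc hn) hx)
  refine (h.congr_of_eventuallyEq ((eventually_pos hx).mono fun y hy => Sc_eq hy)).congr_deriv ?_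
  simp only [ScDeriv]
  ring

theorem hasDerivAt_ScDeriv (hc : 0 ≤ c) (hn : 0 < n) (hx : 0 < 1 + 2 * c * x) :
    HasDerivAt (ScDeriv c n) (ScDeriv2 c n x) x := by
  have h1 := one_add_pos hx
  have hv := hasDerivAt_inv_one_add h1
  have hb := ratioSeq_sqCoeff hc hn
  have h : HasDerivAt (ScDeriv c n) _ x := (hasDerivAt_weight n h1).mul
    (((hv.const_mul (-2 * n)).mul (hasDerivAt_sqSum hb hx)).add
      ((((hasDerivAt_id' x).const_mul 2).mul (hv.pow 3)).mul
        (hasDerivAt_sqSum hb.derivCoeff hx)))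
  refine h.congr_deriv ?_
  simp only [ScDeriv2, Pi.pow_apply, Pi.mul_apply, Nat.cast_ofNat, Nat.add_one_sub_one]
  field_simp
  ring

theorem differentiableAt_ScDeriv2 (hc : 0 ≤ c) (hn : 0 < n) (hx : 0 < 1 + 2 * c * x) :
    DifferentiableAt ℝ (ScDeriv2 c n) x := by
  have h1 := one_add_pos hx
  have hv := (hasDerivAt_inv_one_add h1).differentiableAt
  have hb := ratioSeq_sqCoeff hc hn
  have hw := (hasDerivAt_weight n h1).differentiableAt
  have d0 := (hasDerivAt_sqSum hb hx).differentiableAt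
  have d1 := (hasDerivAt_sqSum hb.derivCoeff hx).differentiableAt
  have d2 := (hasDerivAt_sqSum hb.derivCoeff.derivCoeff hx).differentiableAt
  unfold ScDeriv2
  fun_prop

theorem Sc_ode (hc : 0 ≤ c) (hn : 0 < n) (hx : 0 < 1 + 2 * c * x) :
    x * (1 + c * x) * (1 + 2 * c * x) * ScDeriv2 c n x
      + (4 * (n + c) * x * (1 + c * x) + 1) * ScDeriv c n x
      + 2 * n * (1 + 2 * c * x) * Sc c n x = 0 := by
  have h1 : 1 + x * c ≠ 0 := mul_comm c x ▸ (one_add_pos hx).ne'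
  have h := powSum_sqCoeff_ode hc hn (mul_abs_sq_lt_one hx)
  rw [Sc_eq hx]
  simp only [ScDeriv, ScDeriv2, sqSum]
  generalize powSum (derivCoeff (derivCoeff (sqCoeff c n))) _ = F2 at *
  generalize powSum (derivCoeff (sqCoeff c n)) _ = F1 at *
  generalize powSum (sqCoeff c n) _ = F0 at *
  linear_combination (norm := skip) (4 * x * (1 + c * x)⁻¹ * weight c n x) * h
  field_simp
  ring

theorem Sc_pos (hc : 0 ≤ c) (hn : 0 < n) (hx : 0 < 1 + 2 * c * x) : 0 < Sc c n x := by
  rw [Sc_eq hx]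
  exact mul_pos (weight_pos n (one_add_pos hx))
    ((ratioSeq_sqCoeff hc hn).powSum_pos (mul_abs_sq_lt_one hx) (by positivity))

theorem ScDeriv_zero_neg (hc : 0 ≤ c) (hn : 0 < n) : ScDeriv c n 0 < 0 := by
  have h := Sc_ode (x := 0) hc hn (by simp)
  have := mul_pos hn (Sc_pos (x := 0) hc hn (by simp))
  simp only [mul_zero, zero_mul, zero_add, add_zero, one_mul, mul_one] at h
  linarith

/-- The differentiated differential equation. -/
theorem Sc_ode_deriv (hc : 0 ≤ c) (hn : 0 < n) (hx : 0 < 1 + 2 * c * x) :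
    x * (1 + c * x) * (1 + 2 * c * x) * deriv (ScDeriv2 c n) x
      + (2 + (6 * c + 4 * (n + c)) * x * (1 + c * x)) * ScDeriv2 c n x
      + (6 * n + 4 * c) * (1 + 2 * c * x) * ScDeriv c n x
      + 4 * n * c * Sc c n x = 0 := by
  have i := hasDerivAt_id' x
  have l1 := (i.const_mul c).const_add 1
  have l2 := (i.const_mul (2 * c)).const_add 1
  have h := ((((i.mul l1).mul l2).mul (differentiableAt_ScDeriv2 hc hn hx).hasDerivAt).add
    (((((i.const_mul (4 * (n + c))).mul l1).add_const 1)).mul (hasDerivAt_ScDeriv hc hn hx))).add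
    ((l2.const_mul (2 * n)).mul (hasDerivAt_Sc hc hn hx))
  have h0 := h.unique ((hasDerivAt_const x (0 : ℝ)).congr_of_eventuallyEq
    ((eventually_pos hx).mono fun y hy => by simpa using Sc_ode hc hn hy))
  simp only [Pi.mul_apply] at h0
  linear_combination h0

theorem ScDeriv2_zero_pos (hc : 0 ≤ c) (hn : 0 < n) : 0 < ScDeriv2 c n 0 := by
  have h := Sc_ode (x := 0) hc hn (by simp)
  have h' := Sc_ode_deriv (x := 0) hc hn (by simp)
  have := mul_pos hn (Sc_pos (x := 0) hc hn (by simp))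
  simp only [mul_zero, zero_mul, zero_add, add_zero, one_mul, mul_one] at h h'
  have h1 : ScDeriv c n 0 = -(2 * n * Sc c n 0) := by linarith
  rw [h1] at h'
  nlinarith

end

/-- A function that is positive at `0` and strictly increasing through its zeros is nonnegative. -/
theorem nonneg_of_deriv_pos_of_eq_zero {g g' : ℝ → ℝ} (h0 : 0 < g 0)
    (hg : ∀ x, 0 ≤ x → HasDerivAt g (g' x) x) (h : ∀ x, 0 < x → g x = 0 → 0 < g' x)
    {x : ℝ} (hx : 0 ≤ x) : 0 ≤ g x := by
  have := image_le_of_deriv_right_lt_deriv_boundary' (f := fun _ => 0) (f' := fun _ => 0)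
    (B := g) (B' := g') (a := 0) (b := x) continuousOn_const
    (fun y _ => hasDerivWithinAt_const y _ 0) h0.le
    (fun y hy => (hg y hy.1).continuousAt.continuousWithinAt)
    (fun y hy => (hg y hy.1).hasDerivWithinAt)
    (fun y hy hy0 => h y (hy.1.lt_of_ne' fun e => h0.ne' (e ▸ hy0.symm)) hy0.symm)
  exact this ⟨hx, le_rfl⟩

section

variable {c n x : ℝ}

theorem ScDeriv_nonpos (hc : 0 ≤ c) (hn : 0 < n) (hx : 0 ≤ x) : ScDeriv c n x ≤ 0 := by
  rw [← neg_nonneg]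
  refine nonneg_of_deriv_pos_of_eq_zero (g := fun y => -ScDeriv c n y)
    (g' := fun y => -ScDeriv2 c n y) (neg_pos.2 (ScDeriv_zero_neg hc hn))
    (fun y hy => (hasDerivAt_ScDeriv hc hn (by positivity)).neg) (fun y hy hy0 => ?_) hx
  have hS := Sc_pos (n := n) hc hn (x := y) (by positivity)
  have h := Sc_ode hc hn (x := y) (by positivity)
  rw [neg_eq_zero.1 hy0, mul_zero, add_zero] at h
  have hp : 0 < y * (1 + c * y) * (1 + 2 * c * y) := by positivity
  have : 0 < 2 * n * (1 + 2 * c * y) * Sc c n y := by positivity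
  refine pos_of_mul_pos_right (a := y * (1 + c * y) * (1 + 2 * c * y)) ?_ hp.le
  linarith

theorem ScDeriv2_nonneg (hc : 0 ≤ c) (hn : 0 < n) (hx : 0 ≤ x) : 0 ≤ ScDeriv2 c n x := by
  refine nonneg_of_deriv_pos_of_eq_zero (ScDeriv2_zero_pos hc hn)
    (fun y hy => (differentiableAt_ScDeriv2 hc hn (by positivity)).hasDerivAt)
    (fun y hy hy0 => ?_) hx
  have hS := Sc_pos (n := n) hc hn (x := y) (by positivity)
  have h := Sc_ode hc hn (x := y) (by positivity)
  have h' := Sc_ode_deriv hc hn (x := y) (by positivity)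
  rw [hy0, mul_zero, zero_add] at h
  rw [hy0, mul_zero, add_zero] at h'
  have ha : 0 < 4 * (n + c) * y * (1 + c * y) + 1 := by positivity
  have hp : 0 < y * (1 + c * y) * (1 + 2 * c * y) := by positivity
  have hr : 0 < (12 * n ^ 2 + 4 * n * c
      + (32 * n ^ 2 * c + 16 * n * c ^ 2) * (y * (1 + c * y))) * Sc c n y := by positivity
  refine pos_of_mul_pos_right (a := (4 * (n + c) * y * (1 + c * y) + 1)
    * (y * (1 + c * y) * (1 + 2 * c * y))) ?_ (mul_pos ha hp).le
  refine hr.trans_eq ?_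
  linear_combination ((6 * n + 4 * c) * (1 + 2 * c * y)) * h
    - (4 * (n + c) * y * (1 + c * y) + 1) * h'

theorem hasDerivAt_Tc (hc : 0 ≤ c) (hn : 0 < n) (hx : 0 < 1 + 2 * c * x) :
    HasDerivAt (Tc c n) (-ScDeriv c n x) x :=
  (hasDerivAt_Sc hc hn hx).const_sub 1

theorem iteratedDeriv_two_Tc (hc : 0 ≤ c) (hn : 0 < n) (hx : 0 < 1 + 2 * c * x) :
    iteratedDeriv 2 (Tc c n) x = -ScDeriv2 c n x := by
  rw [iteratedDeriv_succ, iteratedDeriv_one]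
  exact ((hasDerivAt_ScDeriv hc hn hx).neg.congr_of_eventuallyEq
    ((eventually_pos hx).mono fun y hy => (hasDerivAt_Tc hc hn hy).deriv)).deriv

end

theorem stmt12 (c n : ℝ) (hc : 0 ≤ c) (hn : c < n) :
    ConcaveOn ℝ (Set.Ici 0) (Tc c n) ∧ MonotoneOn (Tc c n) (Set.Ici 0) ∧
    ∀ x ∈ Set.Ioi (0 : ℝ),
      x * (1 + c * x) * (1 + 2 * c * x) * iteratedDeriv 2 (Tc c n) x
        + (4 * (n + c) * x * (1 + c * x) + 1) * deriv (Tc c n) x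
        + 2 * n * (1 + 2 * c * x) * Tc c n x = 2 * n * (1 + 2 * c * x) := by
  have hn : 0 < n := hc.trans_lt hn
  have hpos : ∀ x, 0 ≤ x → 0 < 1 + 2 * c * x := fun x hx => by positivity
  have hcont : ContinuousOn (Tc c n) (Set.Ici 0) := fun x hx =>
    (hasDerivAt_Tc hc hn (hpos x hx)).continuousAt.continuousWithinAt
  have hint : ∀ x ∈ interior (Set.Ici (0 : ℝ)), 0 ≤ x := fun x hx => interior_subset hx
  have hderiv : ∀ x ∈ interior (Set.Ici (0 : ℝ)),
      HasDerivWithinAt (Tc c n) (-ScDeriv c n x) (interior (Set.Ici 0)) x := fun x hx =>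
    (hasDerivAt_Tc hc hn (hpos x (hint x hx))).hasDerivWithinAt
  refine ⟨concaveOn_of_hasDerivWithinAt2_nonpos (convex_Ici 0) hcont hderiv
      (fun x hx => (hasDerivAt_ScDeriv hc hn (hpos x (hint x hx))).neg.hasDerivWithinAt)
      (fun x hx => neg_nonpos.2 (ScDeriv2_nonneg hc hn (hint x hx))),
    monotoneOn_of_hasDerivWithinAt_nonneg (convex_Ici 0) hcont hderiv
      (fun x hx => neg_nonneg.2 (ScDeriv_nonpos hc hn (hint x hx))), fun x hx => ?_⟩
  have hx' := hpos x (le_of_lt hx)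
  rw [iteratedDeriv_two_Tc hc hn hx', (hasDerivAt_Tc hc hn hx').deriv]
  simp only [Tc]
  linear_combination -Sc_ode hc hn hx'
end

section
/- Let $c < 0$ and $n = -cl$ with $l \in \mathbb{N}$. Then the Tsallis entropy of order 2, $T_{n,c}(x) := 1 - S_{n,c}(x)$, is concave on $[0,-\frac{1}{c}]$, increasing on $[0,-\frac{1}{2c}]$, and decreasing on $[-\frac{1}{2c},-\frac{1}{c}]$. -/
/-- The basic probabilities `p_{n,k}^{[c]}(x)` for `c < 0`, `n = -c·l`:
`p_{n,k}^{[c]}(x) = C(l,k) (-cx)^k (1+cx)^{l-k}` for `k ≤ l`, and `0` for `k > l`. -/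
noncomputable def pneg (c : ℝ) (l : ℕ) (k : ℕ) (x : ℝ) : ℝ :=
  if k ≤ l then (Nat.choose l k : ℝ) * (-c * x) ^ k * (1 + c * x) ^ (l - k) else 0

/-- `S_{n,c}(x) = ∑_{k=0}^∞ (p_{n,k}^{[c]}(x))²`. -/
noncomputable def Sneg (c : ℝ) (l : ℕ) (x : ℝ) : ℝ :=
  ∑' k : ℕ, (pneg c l k x) ^ 2

/-- The Tsallis entropy of order 2: `T_{n,c}(x) = 1 - S_{n,c}(x)`. -/
noncomputable def Tneg (c : ℝ) (l : ℕ) (x : ℝ) : ℝ := 1 - Sneg c l x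

open Finset in
/-- Parseval's identity on the `N`-th roots of unity. -/
theorem IsPrimitiveRoot.sum_normSq_eq {N : ℕ} {ζ : ℂ} (hζ : IsPrimitiveRoot ζ N) (hN : N ≠ 0)
    (p : ℕ → ℝ) :
    ∑ j ∈ range N, Complex.normSq (∑ k ∈ range N, (p k : ℂ) * (ζ ^ j) ^ k) =
      N * ∑ k ∈ range N, p k ^ 2 := by
  have hnorm : ‖ζ‖ = 1 := hζ.norm'_eq_one hN
  have hζ0 : ζ ≠ 0 := hζ.ne_zero hN
  have hconj : (starRingEnd ℂ) ζ = ζ⁻¹ := (Complex.inv_eq_conj hnorm).symm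
  have orth : ∀ k ∈ range N, ∀ m ∈ range N,
      ∑ j ∈ range N, (ζ ^ k * ζ⁻¹ ^ m) ^ j = if k = m then (N : ℂ) else 0 := by
    intro k hk m hm
    split_ifs with h
    · subst h
      simp [hζ0]
    · have hw : ζ ^ k * ζ⁻¹ ^ m ≠ 1 := by
        intro hw
        rw [inv_pow, mul_inv_eq_one₀ (pow_ne_zero _ hζ0)] at hw
        exact h (hζ.pow_inj (mem_range.1 hk) (mem_range.1 hm) hw)
      have hwN : (ζ ^ k * ζ⁻¹ ^ m) ^ N = 1 := by
        rw [mul_pow, pow_right_comm, pow_right_comm ζ⁻¹, inv_pow, hζ.pow_eq_one]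
        simp
      rw [geom_sum_eq hw, hwN, sub_self, zero_div]
  apply Complex.ofReal_injective
  push_cast
  calc ∑ j ∈ range N, ((Complex.normSq (∑ k ∈ range N, (p k : ℂ) * (ζ ^ j) ^ k) : ℝ) : ℂ)
      = ∑ j ∈ range N, ∑ k ∈ range N, ∑ m ∈ range N,
          (p k : ℂ) * p m * (ζ ^ k * ζ⁻¹ ^ m) ^ j := by
        refine sum_congr rfl fun j _ => ?_
        rw [← Complex.mul_conj, map_sum, sum_mul_sum]
        refine sum_congr rfl fun k _ => sum_congr rfl fun m _ => ?_
        simp only [map_mul, map_pow, Complex.conj_ofReal, hconj]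
        ring
    _ = ∑ k ∈ range N, ∑ m ∈ range N, (p k : ℂ) * p m *
          ∑ j ∈ range N, (ζ ^ k * ζ⁻¹ ^ m) ^ j := by
        rw [sum_comm]
        refine sum_congr rfl fun k _ => ?_
        rw [sum_comm]
        exact sum_congr rfl fun m _ => (mul_sum _ _ _).symm
    _ = ∑ k ∈ range N, (p k : ℂ) * p k * N := by
        refine sum_congr rfl fun k hk => ?_
        rw [sum_eq_single_of_mem k hk fun m hm hmk => by
          rw [orth k hk m hm, if_neg hmk.symm, mul_zero], orth k hk k hk, if_pos rfl]
    _ = N * ∑ k ∈ range N, (p k : ℂ) ^ 2 := by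
        rw [mul_sum]
        exact sum_congr rfl fun k _ => by ring

theorem normSq_one_add_mul_eq {z : ℂ} (hz : ‖z‖ = 1) (c x : ℝ) :
    Complex.normSq (((-c * x : ℝ) : ℂ) * z + ((1 + c * x : ℝ) : ℂ)) =
      1 + 2 * (1 - z.re) * (c * x * (1 + c * x)) := by
  have h : z.re * z.re + z.im * z.im = 1 := by
    rw [← Complex.normSq_apply, Complex.normSq_eq_norm_sq, hz, one_pow]
  rw [Complex.normSq_apply]
  simp only [Complex.add_re, Complex.add_im, Complex.re_ofReal_mul, Complex.im_ofReal_mul,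
    Complex.ofReal_re, Complex.ofReal_im]
  linear_combination (c * x) ^ 2 * h

open Finset in
theorem Sneg_eq_sum_range (c : ℝ) (l : ℕ) (x : ℝ) :
    Sneg c l x = ∑ k ∈ range (l + 1), pneg c l k x ^ 2 := by
  refine tsum_eq_sum fun k hk => ?_
  have : ¬ k ≤ l := by simpa [Nat.lt_succ_iff] using hk
  simp [pneg, this]

open Finset in
theorem sum_pneg_mul_pow (c : ℝ) (l : ℕ) (x : ℝ) (z : ℂ) :
    ∑ k ∈ range (l + 1), (pneg c l k x : ℂ) * z ^ k =
      (((-c * x : ℝ) : ℂ) * z + ((1 + c * x : ℝ) : ℂ)) ^ l := by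
  rw [add_pow]
  refine sum_congr rfl fun k hk => ?_
  rw [pneg, if_pos (Nat.lt_succ_iff.1 (mem_range.1 hk))]
  push_cast
  ring

open Finset in
/-- `S_{n,c}` is an average of `l`-th powers of nonnegative convex quadratic polynomials, all of
them symmetric about `-1/(2c)`. -/
theorem exists_Sneg_eq (c : ℝ) (l : ℕ) : ∃ a : ℕ → ℝ, (∀ j, 0 ≤ a j) ∧
    (∀ j x, 0 ≤ 1 + a j * (c * x * (1 + c * x))) ∧
    ∀ x, Sneg c l x =
      ((l + 1 : ℕ) : ℝ)⁻¹ * ∑ j ∈ range (l + 1), (1 + a j * (c * x * (1 + c * x))) ^ l := by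
  have hN : l + 1 ≠ 0 := l.succ_ne_zero
  obtain ⟨ζ, hζ⟩ : ∃ ζ : ℂ, IsPrimitiveRoot ζ (l + 1) :=
    ⟨_, Complex.isPrimitiveRoot_exp (l + 1) hN⟩
  have hnorm : ∀ j : ℕ, ‖ζ ^ j‖ = 1 := fun j => by
    rw [norm_pow, hζ.norm'_eq_one hN, one_pow]
  refine ⟨fun j => 2 * (1 - (ζ ^ j).re), fun j => ?_, fun j x => ?_, fun x => ?_⟩
  · have := (ζ ^ j).re_le_norm
    rw [hnorm] at this
    linarith
  · rw [← normSq_one_add_mul_eq (hnorm j)]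
    exact Complex.normSq_nonneg _
  · have h := hζ.sum_normSq_eq hN fun k => pneg c l k x
    simp only [sum_pneg_mul_pow, map_pow, normSq_one_add_mul_eq (hnorm _)] at h
    rw [h, ← Sneg_eq_sum_range, inv_mul_cancel_left₀ (Nat.cast_ne_zero.2 hN)]

theorem Sneg_le_Sneg {c x y : ℝ} (l : ℕ)
    (h : c * x * (1 + c * x) ≤ c * y * (1 + c * y)) : Sneg c l x ≤ Sneg c l y := by
  obtain ⟨a, ha, hq, hS⟩ := exists_Sneg_eq c l
  rw [hS, hS]
  gcongr with j
  · exact hq j x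
  · exact ha j

theorem convexOn_Sneg (c : ℝ) (l : ℕ) : ConvexOn ℝ Set.univ (Sneg c l) := by
  obtain ⟨a, ha, hq, hS⟩ := exists_Sneg_eq c l
  have hconv : ∀ j, ConvexOn ℝ Set.univ fun x => 1 + a j * (c * x * (1 + c * x)) := by
    refine fun j => ⟨convex_univ, fun x _ y _ s t hs ht hst => ?_⟩
    obtain rfl : s = 1 - t := by linarith
    have : 0 ≤ a j * ((1 - t) * t * (c * (x - y)) ^ 2) :=
      mul_nonneg (ha j) (mul_nonneg (mul_nonneg hs ht) (sq_nonneg _))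
    simp only [smul_eq_mul]
    linarith
  rw [funext hS]
  refine ConvexOn.smul (by positivity) ?_
  refine ⟨convex_univ, fun x hx y hy s t hs ht hst => ?_⟩
  simp only [Finset.smul_sum, ← Finset.sum_add_distrib]
  exact Finset.sum_le_sum fun j _ =>
    ((hconv j).pow (fun x _ => hq j x) l).2 hx hy hs ht hst

theorem stmt13 (c : ℝ) (hc : c < 0) (l : ℕ) (hl : 0 < l) :
    ConcaveOn ℝ (Set.Icc 0 (-1 / c)) (Tneg c l) ∧
    MonotoneOn (Tneg c l) (Set.Icc 0 (-1 / (2 * c))) ∧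
    AntitoneOn (Tneg c l) (Set.Icc (-1 / (2 * c)) (-1 / c)) := by
  have h2c : 2 * c < 0 := by linarith
  refine ⟨?_, fun x hx y hy hxy => ?_, fun x hx y hy hxy => ?_⟩
  · exact (concaveOn_const 1 (convex_Icc _ _)).sub
      ((convexOn_Sneg c l).subset (Set.subset_univ _) (convex_Icc _ _))
  · refine sub_le_sub_left (Sneg_le_Sneg l ?_) 1
    have hx' := (le_div_iff_of_neg h2c).1 hx.2
    have hy' := (le_div_iff_of_neg h2c).1 hy.2
    have := mul_nonneg (mul_nonneg (neg_nonneg.2 hc.le) (sub_nonneg.2 hxy))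
      (show 0 ≤ 1 + c * x + c * y by linarith)
    linarith
  · refine sub_le_sub_left (Sneg_le_Sneg l ?_) 1
    have hx' := (div_le_iff_of_neg h2c).1 hx.1
    have hy' := (div_le_iff_of_neg h2c).1 hy.1
    have := mul_nonneg (mul_nonneg (neg_nonneg.2 hc.le) (sub_nonneg.2 hxy))
      (show 0 ≤ -(1 + c * x + c * y) by linarith)
    linarith
end

section
/- For every integer $n \ge 2$: $S_{n,-1}\left(\frac{1}{2}\right) = \frac{1}{4^n}\binom{2n}{n}$, $S''_{n,-1}\left(\frac{1}{2}\right) = \frac{1}{4^{n-2}}\binom{2n-2}{n-1}$, and $S^{(4)}_{n,-1}\left(\frac{1}{2}\right) = \frac{9}{4^{n-4}}\binom{2n-4}{n-2}$. -/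
/-- `S_{n,-1}(x) = ∑_{k=0}^n (C(n,k) xᵏ (1-x)^{n-k})²`. -/
noncomputable def Sb (n : ℕ) (x : ℝ) : ℝ :=
  ∑ k ∈ Finset.range (n + 1),
    ((Nat.choose n k : ℝ) * x ^ k * (1 - x) ^ (n - k)) ^ 2

open Polynomial in
theorem coeff_C_mul_X_add_C_pow (a b : ℝ) (n k : ℕ) :
    ((C a * X + C b) ^ n).coeff k = (n.choose k : ℝ) * a ^ k * b ^ (n - k) := by
  have h (m : ℕ) : (C a * X) ^ m * C b ^ (n - m) * (n.choose m : ℝ[X])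
      = C (a ^ m * b ^ (n - m) * (n.choose m : ℝ)) * X ^ m := by
    simp only [mul_pow, map_mul, map_pow, map_natCast]
    ring
  rw [add_pow, finsetSum_coeff]
  simp only [h, coeff_C_mul_X_pow]
  rw [Finset.sum_ite_eq]
  split_ifs with hk
  · ring
  · rw [Nat.choose_eq_zero_of_lt (by simpa using hk)]
    simp

open Polynomial in
/-- The sum of squared binomial terms is the middle coefficient of `((pX + q)(qX + p))ⁿ`. -/
theorem sum_sq_choose_eq_coeff (p q : ℝ) (n : ℕ) :
    ∑ k ∈ Finset.range (n + 1), ((n.choose k : ℝ) * p ^ k * q ^ (n - k)) ^ 2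
      = (((C p * X + C q) * (C q * X + C p)) ^ n).coeff n := by
  rw [mul_pow, coeff_mul, Finset.Nat.sum_antidiagonal_eq_sum_range_succ_mk]
  refine Finset.sum_congr rfl fun k hk => ?_
  have hk' : k ≤ n := by simpa [Nat.lt_succ_iff] using hk
  simp only [coeff_C_mul_X_add_C_pow, Nat.choose_symm hk', Nat.sub_sub_self hk']
  ring

open Polynomial in
/-- The coefficient of `zⁿ` in `(1 - z)²ʲ (1 + z)²⁽ⁿ⁻ʲ⁾`. -/
noncomputable def middleCoeff (n j : ℕ) : ℝ :=
  (((1 - X) ^ (2 * j) * (1 + X) ^ (2 * (n - j)) : ℝ[X])).coeff n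

open Polynomial in
theorem Sb_eq_sum (n : ℕ) (x : ℝ) :
    Sb n x = ∑ j ∈ Finset.range (n + 1),
      ((-1) ^ j * 4 ^ j / 4 ^ n * (n.choose j : ℝ) * middleCoeff n j) * (x - 1 / 2) ^ (2 * j) := by
  have hfac : (C x * X + C (1 - x)) * (C (1 - x) * X + C x)
      = C (1 / 4 : ℝ) * (C (-(4 * (x - 1 / 2) ^ 2)) * (1 - X) ^ 2 + (1 + X) ^ 2) := by
    have h4 : (C (1 / 4 : ℝ)) * 4 = 1 := by
      rw [← C_ofNat, ← C_mul]; norm_num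
    have h2 : (C (1 / 2 : ℝ)) = 2 * C (1 / 4 : ℝ) := by
      rw [← C_ofNat, ← C_mul]; norm_num
    simp only [C_sub, C_neg, C_mul, C_pow, C_1, C_ofNat, h2]
    generalize C (1 / 4 : ℝ) = u at *
    generalize C x = y
    grind
  rw [Sb, sum_sq_choose_eq_coeff, hfac, mul_pow, ← C_pow, coeff_C_mul, add_pow,
    finsetSum_coeff, Finset.mul_sum]
  refine Finset.sum_congr rfl fun j _ => ?_
  have h : (C (-(4 * (x - 1 / 2) ^ 2)) * (1 - X) ^ 2) ^ j * ((1 + X) ^ 2) ^ (n - j)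
        * (n.choose j : ℝ[X])
      = C ((-(4 * (x - 1 / 2) ^ 2)) ^ j * (n.choose j : ℝ))
        * ((1 - X) ^ (2 * j) * (1 + X) ^ (2 * (n - j))) := by
    rw [C_mul, C_pow, C_eq_natCast, mul_pow, pow_mul, pow_mul]
    ring
  rw [h, coeff_C_mul, ← middleCoeff, neg_eq_neg_one_mul, mul_pow, mul_pow, pow_mul, one_div_pow]
  ring

theorem iteratedDeriv_Sb_half (n i : ℕ) (hi : i ≤ n) :
    iteratedDeriv (2 * i) (Sb n) (1 / 2)
      = (2 * i).factorial * ((-1) ^ i * 4 ^ i / 4 ^ n * (n.choose i : ℝ) * middleCoeff n i) := by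
  rw [show Sb n = _ from funext (Sb_eq_sum n),
    iteratedDeriv_fun_sum fun j _ => by fun_prop,
    Finset.sum_eq_single_of_mem i (Finset.mem_range.2 (by lia))]
  · rw [iteratedDeriv_const_mul_field,
      iteratedDeriv_comp_sub_const (2 * i) (fun y : ℝ => y ^ (2 * i))]
    simp [Nat.descFactorial_self, mul_comm]
  · intro j _ hj
    rw [iteratedDeriv_const_mul_field,
      iteratedDeriv_comp_sub_const (2 * i) (fun y : ℝ => y ^ (2 * j))]
    rcases lt_or_gt_of_ne hj with h | h
    · simp [Nat.descFactorial_eq_zero_iff_lt.2 (show 2 * j < 2 * i by lia)]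
    · simp [show 2 * j - 2 * i ≠ 0 by lia]

theorem middleCoeff_zero (n : ℕ) : middleCoeff n 0 = ((2 * n).choose n : ℝ) := by
  simp [middleCoeff, Polynomial.coeff_one_add_X_pow]

open Polynomial in
theorem succ_mul_middleCoeff_one (m : ℕ) :
    ((m : ℝ) + 1) * middleCoeff (m + 1) 1 = -2 * ((2 * m).choose m : ℝ) := by
  have hp : ((1 - X) ^ 2 * (1 + X) ^ (2 * m) : ℝ[X])
      = (1 + X) ^ (2 * m + 2) - C 4 * ((1 + X) ^ (2 * m) * X) := by
    rw [pow_add, C_ofNat]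
    ring
  have hc : middleCoeff (m + 1) 1
      = ((2 * m + 2).choose (m + 1) : ℝ) - 4 * ((2 * m).choose m : ℝ) := by
    simp only [middleCoeff, Nat.add_sub_cancel, mul_one]
    rw [hp, coeff_sub, coeff_C_mul, coeff_mul_X, coeff_one_add_X_pow, coeff_one_add_X_pow]
  have hs := congrArg (Nat.cast : ℕ → ℝ) (Nat.succ_mul_centralBinom_succ m)
  simp only [Nat.centralBinom] at hs
  push_cast at hs
  rw [show 2 * (m + 1) = 2 * m + 2 by ring] at hs
  rw [hc]
  linarith

open Polynomial in
theorem mul_middleCoeff_two (m : ℕ) :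
    ((m : ℝ) + 1) * (m + 2) * middleCoeff (m + 2) 2 = 12 * ((2 * m).choose m : ℝ) := by
  have hp : ((1 - X) ^ 4 * (1 + X) ^ (2 * m) : ℝ[X])
      = (1 + X) ^ (2 * m + 4) - C 8 * ((1 + X) ^ (2 * m + 2) * X)
        + C 16 * ((1 + X) ^ (2 * m) * X ^ 2) := by
    rw [pow_add, pow_add, C_ofNat, C_ofNat]
    ring
  have hc : middleCoeff (m + 2) 2
      = ((2 * m + 4).choose (m + 2) : ℝ) - 8 * ((2 * m + 2).choose (m + 1) : ℝ)
        + 16 * ((2 * m).choose m : ℝ) := by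
    simp only [middleCoeff, Nat.add_sub_cancel, Nat.reduceMul]
    rw [hp, coeff_add, coeff_sub, coeff_C_mul, coeff_C_mul, coeff_mul_X, coeff_mul_X_pow]
    simp only [coeff_one_add_X_pow]
  have h1 := congrArg (Nat.cast : ℕ → ℝ) (Nat.succ_mul_centralBinom_succ m)
  have h2 := congrArg (Nat.cast : ℕ → ℝ) (Nat.succ_mul_centralBinom_succ (m + 1))
  simp only [Nat.centralBinom] at h1 h2
  push_cast at h1 h2
  rw [show 2 * (m + 1 + 1) = 2 * m + 4 by ring] at h2
  rw [show 2 * (m + 1) = 2 * m + 2 by ring] at h1 h2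
  rw [hc]
  linear_combination ((m : ℝ) + 1) * h2 + (2 * (2 * (m : ℝ) + 3) - 8 * (m + 2)) * h1

theorem stmt14 (n : ℕ) (hn : 2 ≤ n) :
    Sb n (1 / 2) = 1 / 4 ^ n * (Nat.choose (2 * n) n : ℝ) ∧
    iteratedDeriv 2 (Sb n) (1 / 2)
      = 1 / (4 : ℝ) ^ ((n : ℤ) - 2) * (Nat.choose (2 * n - 2) (n - 1) : ℝ) ∧
    iteratedDeriv 4 (Sb n) (1 / 2)
      = 9 / (4 : ℝ) ^ ((n : ℤ) - 4) * (Nat.choose (2 * n - 4) (n - 2) : ℝ) := by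
  obtain ⟨m, rfl⟩ := Nat.exists_eq_add_of_le' hn
  have h0 := iteratedDeriv_Sb_half (m + 2) 0 (by lia)
  have h1 := iteratedDeriv_Sb_half (m + 2) 1 (by lia)
  have h2 := iteratedDeriv_Sb_half (m + 2) 2 (by lia)
  have c1 := succ_mul_middleCoeff_one (m + 1)
  have c2 := mul_middleCoeff_two m
  have hchoose : (((m + 2).choose 2 : ℕ) : ℝ) = (m + 2) * (m + 1) / 2 := by
    rw [Nat.cast_choose_two]
    push_cast
    ring
  refine ⟨?_, ?_, ?_⟩
  · simpa [middleCoeff_zero] using h0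
  · rw [show 2 * (m + 2) - 2 = 2 * (m + 1) by lia, show m + 2 - 1 = m + 1 by lia,
      zpow_sub₀ (by norm_num), zpow_natCast]
    rw [mul_one] at h1
    rw [h1, Nat.choose_one_right]
    push_cast [Nat.factorial] at c1 ⊢
    field_simp
    linear_combination (-2) * c1
  · rw [show 2 * (m + 2) - 4 = 2 * m by lia, Nat.add_sub_cancel,
      zpow_sub₀ (by norm_num), zpow_natCast]
    rw [show 2 * 2 = 4 from rfl] at h2
    rw [h2, hchoose]
    norm_num [Nat.factorial]
    field_simp
    linear_combination 384 * c2
end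

section
/- For every $n \in \mathbb{N}$ and every real $t \ne -1$, $f_n(t) = \frac{1}{2n}(t+1)^{2n-1} S'_{n,-1}\left(\frac{t}{t+1}\right)$; moreover, for every integer $i$ with $0 \le i \le 2n-1$ and every $t \ge 1$, the $i$-th derivative satisfies $f_n^{(i)}(t) \ge 0$. -/
/-- `f_n(t) = ∑_{j=0}^{n-1} C(n-1,j) (C(n,j+1) t^{2j+1} - C(n,j) t^{2j})`. -/
noncomputable def fb (n : ℕ) (t : ℝ) : ℝ :=
  ∑ j ∈ Finset.range n,
    (Nat.choose (n - 1) j : ℝ)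
      * ((Nat.choose n (j + 1) : ℝ) * t ^ (2 * j + 1)
        - (Nat.choose n j : ℝ) * t ^ (2 * j))

open Polynomial in
theorem coeff_one_add_X_pow_mul_one_sub_X_pow (k m : ℕ) :
    (-1) ^ k * ((1 + X) ^ (2 * m) * (1 - X) ^ (2 * k) : ℝ[X]).coeff (k + m) =
      ((2 * k).factorial * (2 * m).factorial : ℝ) /
        (k.factorial * m.factorial * (k + m).factorial) := by
  induction k generalizing m with
  | zero =>
    have h := Nat.choose_mul_factorial_mul_factorial (n := 2 * m) (k := m) (by lia)
    rw [show 2 * m - m = m by lia] at h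
    simp only [mul_zero, pow_zero, mul_one, one_mul, zero_add, coeff_one_add_X_pow,
      Nat.factorial_zero, Nat.cast_one]
    rw [eq_div_iff (by positivity), ← mul_assoc]
    exact_mod_cast h
  | succ k ih =>
    have key : ((1 + X) ^ (2 * m) * (1 - X) ^ (2 * (k + 1)) : ℝ[X]) =
        (1 + X) ^ (2 * (m + 1)) * (1 - X) ^ (2 * k)
          - C 4 * ((1 + X) ^ (2 * m) * (1 - X) ^ (2 * k) * X) := by
      rw [show (C 4 : ℝ[X]) = 4 from rfl]
      ring
    have h1 := ih (m + 1)
    have h2 := ih m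
    rw [show k + 1 + m = k + m + 1 by lia, key, coeff_sub, coeff_C_mul, coeff_mul_X, pow_succ]
    rw [show k + (m + 1) = k + m + 1 by lia] at h1
    have expand : ∀ a b : ℝ, (-1) ^ k * -1 * (a - 4 * b) =
        4 * ((-1) ^ k * b) - (-1) ^ k * a := fun a b => by ring
    rw [expand, h1, h2]
    simp only [show 2 * (m + 1) = 2 * m + 1 + 1 by ring, show 2 * (k + 1) = 2 * k + 1 + 1 by ring,
      Nat.factorial_succ]
    push_cast
    field_simp
    ring

open Polynomial in
theorem coeff_linear_pow_mul_linear_pow (n : ℕ) (a b : ℝ) :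
    ((C a * X + C b) ^ n * (C b * X + C a) ^ n : ℝ[X]).coeff n =
      ∑ k ∈ Finset.range (n + 1), ((Nat.choose n k : ℝ) * a ^ k * b ^ (n - k)) ^ 2 := by
  have coeff_pow : ∀ (c d : ℝ) (k : ℕ), ((C c * X + C d) ^ n : ℝ[X]).coeff k =
      c ^ k * d ^ (n - k) * n.choose k := by
    intro c d k
    have : (C c * X + C d : ℝ[X]) ^ n = ((X + C d) ^ n).comp (C c * X) := by simp
    rw [this, comp_C_mul_X_coeff, coeff_X_add_C_pow]
    ring
  rw [coeff_mul, Finset.Nat.sum_antidiagonal_eq_sum_range_succ_mk]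
  refine Finset.sum_congr rfl fun k hk => ?_
  have hk : k ≤ n := by simpa [Nat.lt_succ_iff] using hk
  rw [coeff_pow, coeff_pow, Nat.choose_symm hk, Nat.sub_sub_self hk]
  ring

open Polynomial in
/-- The sum of squared Bernstein polynomials is a combination of even powers of `2 * x - 1`
with nonnegative coefficients. -/
theorem exists_nonneg_Sb_eq_sum (n : ℕ) : ∃ c : ℕ → ℝ, (∀ k, 0 ≤ c k) ∧
    ∀ x, Sb n x = ∑ k ∈ Finset.range (n + 1), c k * (2 * x - 1) ^ (2 * k) := by
  refine ⟨fun k => n.choose k / 4 ^ n * (((2 * k).factorial * (2 * (n - k)).factorial : ℝ) /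
    (k.factorial * (n - k).factorial * (k + (n - k)).factorial)), fun k => by positivity,
    fun x => ?_⟩
  have hpoly : ((C x * X + C (1 - x)) ^ n * (C (1 - x) * X + C x) ^ n : ℝ[X]) =
      C (1 / 4 ^ n) * ((1 + X) ^ 2 + C (-(2 * x - 1) ^ 2) * (1 - X) ^ 2) ^ n := by
    have hbase : (C x * X + C (1 - x)) * (C (1 - x) * X + C x) =
        C (1 / 4) * ((1 + X) ^ 2 + C (-(2 * x - 1) ^ 2) * (1 - X) ^ 2 : ℝ[X]) := by
      refine Polynomial.funext fun r => ?_
      simp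
      ring
    rw [← mul_pow, hbase, mul_pow, ← C_pow, one_div_pow]
  rw [Sb, ← coeff_linear_pow_mul_linear_pow, hpoly, coeff_C_mul, add_comm ((1 + X) ^ 2 : ℝ[X]),
    add_pow, finsetSum_coeff, Finset.mul_sum]
  refine Finset.sum_congr rfl fun k hk => ?_
  have hk : k ≤ n := by simpa [Nat.lt_succ_iff] using hk
  beta_reduce
  rw [← coeff_one_add_X_pow_mul_one_sub_X_pow, Nat.add_sub_cancel' hk]
  have hterm : ((C (-(2 * x - 1) ^ 2) * (1 - X) ^ 2) ^ k * ((1 + X) ^ 2) ^ (n - k) *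
      (n.choose k : ℝ[X])) = C ((-(2 * x - 1) ^ 2) ^ k * n.choose k) *
        ((1 + X) ^ (2 * (n - k)) * (1 - X) ^ (2 * k)) := by
    rw [C_mul, C_pow, C_eq_natCast, mul_pow, ← pow_mul, ← pow_mul]
    ring
  rw [hterm, coeff_C_mul, neg_pow ((2 * x - 1) ^ 2), ← pow_mul]
  ring

theorem hasDerivAt_Sb (m : ℕ) (x : ℝ) :
    HasDerivAt (Sb (m + 1)) (∑ j ∈ Finset.range (m + 1), 2 * (m + 1) * (Nat.choose m j : ℝ) *
      ((Nat.choose (m + 1) (j + 1) : ℝ) * (x ^ (2 * j + 1) * (1 - x) ^ (2 * (m - j)))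
        - (Nat.choose (m + 1) j : ℝ) * (x ^ (2 * j) * (1 - x) ^ (2 * (m - j) + 1)))) x := by
  have hd : HasDerivAt (Sb (m + 1)) (∑ k ∈ Finset.range (m + 1 + 1),
      ((Nat.choose (m + 1) k : ℝ) ^ 2 * (((2 * k : ℕ) : ℝ) * x ^ (2 * k - 1) *
          (1 - x) ^ (2 * (m + 1 - k)))
        - (Nat.choose (m + 1) k : ℝ) ^ 2 * (x ^ (2 * k) * (((2 * (m + 1 - k) : ℕ) : ℝ) *
          (1 - x) ^ (2 * (m + 1 - k) - 1))))) x := by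
    unfold Sb
    refine HasDerivAt.fun_sum fun k _ => ?_
    have h1 := hasDerivAt_pow (2 * k) x
    have h2 := ((hasDerivAt_id x).const_sub 1).fun_pow (2 * (m + 1 - k))
    have h3 := (h1.fun_mul h2).const_mul ((Nat.choose (m + 1) k : ℝ) ^ 2)
    refine (h3.congr_deriv ?_).congr_of_eventuallyEq (Filter.Eventually.of_forall fun y => ?_)
    · simp only [id]
      ring
    · simp only [id]
      ring
  refine hd.congr_deriv ?_
  rw [Finset.sum_sub_distrib, Finset.sum_range_succ', Finset.sum_range_succ _ (m + 1)]
  simp only [Nat.sub_self, mul_zero, Nat.cast_zero, zero_mul, add_zero]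
  rw [← Finset.sum_sub_distrib]
  refine Finset.sum_congr rfl fun j hj => ?_
  have hj : j ≤ m := by simpa [Nat.lt_succ_iff] using hj
  have e1 : ((m + 1 : ℕ) : ℝ) * (m.choose j : ℝ) =
      ((m + 1).choose (j + 1) : ℝ) * ((j + 1 : ℕ) : ℝ) := by
    exact_mod_cast Nat.add_one_mul_choose_eq m j
  have e2 : (m.choose j : ℝ) * ((m + 1 : ℕ) : ℝ) =
      ((m + 1).choose j : ℝ) * ((m - j + 1 : ℕ) : ℝ) := by
    have := Nat.choose_mul_succ_eq m j
    rw [show m + 1 - j = m - j + 1 by lia] at this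
    exact_mod_cast this
  rw [show 2 * (j + 1) - 1 = 2 * j + 1 by lia, show m + 1 - (j + 1) = m - j by lia,
    show m + 1 - j = m - j + 1 by lia, show 2 * (m - j + 1) - 1 = 2 * (m - j) + 1 by lia]
  rw [Nat.cast_mul 2 (j + 1), Nat.cast_mul 2 (m - j + 1)]
  rw [Nat.cast_add_one m] at e1 e2
  rw [Nat.cast_ofNat]
  linear_combination (-2 * ((m + 1).choose (j + 1) : ℝ) * (x ^ (2 * j + 1) *
    (1 - x) ^ (2 * (m - j)))) * e1 + (2 * ((m + 1).choose j : ℝ) * (x ^ (2 * j) *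
    (1 - x) ^ (2 * (m - j) + 1))) * e2

theorem fb_eq_deriv_Sb (n : ℕ) (hn : 0 < n) (t : ℝ) (ht : t ≠ -1) :
    fb n t = 1 / (2 * n) * (t + 1) ^ (2 * n - 1) * deriv (Sb n) (t / (t + 1)) := by
  obtain ⟨m, rfl⟩ : ∃ m, n = m + 1 := ⟨n - 1, by lia⟩
  have h : t + 1 ≠ 0 := fun h => ht (by linarith)
  rw [(hasDerivAt_Sb m _).deriv, fb, Finset.mul_sum]
  refine Finset.sum_congr rfl fun j hj => ?_
  have hj : j ≤ m := by simpa [Nat.lt_succ_iff] using hj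
  obtain ⟨d, rfl⟩ := Nat.exists_eq_add_of_le hj
  rw [show 1 - t / (t + 1) = 1 / (t + 1) by field_simp; ring, Nat.add_sub_cancel_left,
    Nat.add_sub_cancel, show 2 * (j + d + 1) - 1 = 2 * j + 1 + 2 * d by lia]
  have hm : ((j + d : ℕ) : ℝ) + 1 ≠ 0 := by positivity
  rw [Nat.cast_add_one (j + d)]
  generalize ((j + d : ℕ) : ℝ) + 1 = M at hm
  simp only [div_pow, one_pow]
  field_simp
  ring

/-- Analytic functions all of whose derivatives are nonnegative on `[1, ∞)`. -/
def DerivsNonneg (f : ℝ → ℝ) : Prop :=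
  ContDiff ℝ ⊤ f ∧ ∀ (i : ℕ) (t : ℝ), 1 ≤ t → 0 ≤ iteratedDeriv i f t

namespace DerivsNonneg

variable {f g : ℝ → ℝ}

theorem const {c : ℝ} (hc : 0 ≤ c) : DerivsNonneg fun _ => c := by
  refine ⟨contDiff_const, fun i t _ => ?_⟩
  rw [iteratedDeriv_const]
  split_ifs <;> simp [hc]

theorem add_const {c : ℝ} (hc : -1 ≤ c) : DerivsNonneg fun t => t + c := by
  refine ⟨by fun_prop, fun i t ht => ?_⟩
  rcases i with _ | i
  · simp only [iteratedDeriv_zero]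
    linarith
  · have : deriv (fun t : ℝ => t + c) = fun _ => 1 := by
      ext
      simp
    rw [iteratedDeriv_succ', this]
    exact (const zero_le_one).2 i t ht

theorem mul (hf : DerivsNonneg f) (hg : DerivsNonneg g) : DerivsNonneg fun t => f t * g t := by
  refine ⟨hf.1.mul hg.1, fun i t ht => ?_⟩
  rw [iteratedDeriv_fun_mul (hf.1.contDiffAt.of_le le_top) (hg.1.contDiffAt.of_le le_top)]
  exact Finset.sum_nonneg fun j _ =>
    mul_nonneg (mul_nonneg (Nat.cast_nonneg _) (hf.2 _ _ ht)) (hg.2 _ _ ht)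

theorem pow (hf : DerivsNonneg f) (k : ℕ) : DerivsNonneg fun t => f t ^ k := by
  induction k with
  | zero => simpa using const zero_le_one
  | succ k ih => simpa only [pow_succ] using ih.mul hf

theorem sum {ι : Type*} {s : Finset ι} {F : ι → ℝ → ℝ} (hF : ∀ j ∈ s, DerivsNonneg (F j)) :
    DerivsNonneg fun t => ∑ j ∈ s, F j t := by
  refine ⟨ContDiff.sum fun j hj => (hF j hj).1, fun i t ht => ?_⟩
  rw [iteratedDeriv_fun_sum fun j hj => (hF j hj).1.contDiffAt.of_le le_top]
  exact Finset.sum_nonneg fun j hj => (hF j hj).2 i t ht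

end DerivsNonneg

theorem exists_nonneg_fb_eq_sum (n : ℕ) (hn : 0 < n) : ∃ c : ℕ → ℝ, (∀ k, 0 ≤ c k) ∧
    ∀ t : ℝ, t ≠ -1 → fb n t =
      ∑ k ∈ Finset.range n, c k * (t - 1) ^ (2 * k + 1) * (t + 1) ^ (2 * (n - 1 - k)) := by
  obtain ⟨c, hc, hS⟩ := exists_nonneg_Sb_eq_sum n
  refine ⟨fun k => 1 / (2 * n) * (c (k + 1) * (4 * (k + 1))), fun k => ?_, fun t ht => ?_⟩
  · have := hc (k + 1)
    positivity
  have h : t + 1 ≠ 0 := fun h => ht (by linarith)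
  have hd : ∀ x, HasDerivAt (Sb n) (∑ k ∈ Finset.range (n + 1),
      c k * (((2 * k : ℕ) : ℝ) * (2 * x - 1) ^ (2 * k - 1) * (2 * 1))) x := by
    intro x
    rw [funext hS]
    exact HasDerivAt.fun_sum fun k _ =>
      ((((hasDerivAt_id x).const_mul 2).sub_const 1).fun_pow (2 * k)).const_mul (c k)
  rw [fb_eq_deriv_Sb n hn t ht, (hd _).deriv, Finset.sum_range_succ']
  simp only [mul_zero, Nat.cast_zero, zero_mul, add_zero]
  rw [Finset.mul_sum]
  refine Finset.sum_congr rfl fun k hk => ?_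
  obtain ⟨d, rfl⟩ := Nat.exists_eq_add_of_lt (Finset.mem_range.mp hk)
  rw [show 2 * (t / (t + 1)) - 1 = (t - 1) / (t + 1) by field_simp; ring,
    show 2 * (k + 1) - 1 = 2 * k + 1 by lia, show k + d + 1 - 1 - k = d by lia,
    show 2 * (k + d + 1) - 1 = 2 * k + 1 + 2 * d by lia, div_pow, pow_add (t + 1)]
  have hm : ((k + d + 1 : ℕ) : ℝ) ≠ 0 := by positivity
  generalize ((k + d + 1 : ℕ) : ℝ) = M at hm
  push_cast
  field_simp
  ring

theorem stmt17 (n : ℕ) (hn : 0 < n) :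
    (∀ t : ℝ, t ≠ -1 →
      fb n t = 1 / (2 * n) * (t + 1) ^ (2 * n - 1) * deriv (Sb n) (t / (t + 1))) ∧
    (∀ i : ℕ, i ≤ 2 * n - 1 → ∀ t : ℝ, 1 ≤ t → 0 ≤ iteratedDeriv i (fb n) t) := by
  refine ⟨fb_eq_deriv_Sb n hn, fun i _ t ht => ?_⟩
  obtain ⟨c, hc, hf⟩ := exists_nonneg_fb_eq_sum n hn
  have hev : fb n =ᶠ[nhds t] fun t => ∑ k ∈ Finset.range n,
      c k * (t - 1) ^ (2 * k + 1) * (t + 1) ^ (2 * (n - 1 - k)) := by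
    filter_upwards [isOpen_ne.mem_nhds (show t ≠ -1 by linarith)] with s hs using hf s hs
  rw [hev.iteratedDeriv_eq]
  refine (DerivsNonneg.sum fun k _ => ?_).2 i t ht
  exact ((DerivsNonneg.const (hc k)).mul ((DerivsNonneg.add_const le_rfl).pow _)).mul
    ((DerivsNonneg.add_const (by norm_num)).pow _)
end

section
/- For every $n \in \mathbb{N}$ and every integer $i$ with $0 \le i \le 2n-1$, $\sum_{j=\lfloor i/2 \rfloor}^{n-1} \binom{n-1}{j}\left(\binom{n}{j+1}\binom{2j+1}{i} - \binom{n}{j}\binom{2j}{i}\right) \ge 0$. -/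
open Polynomial in
theorem coeff_one_add_C_mul_X_pow {R : Type*} [CommRing R] (t : R) (m j : ℕ) :
    ((1 + C t * X : R[X]) ^ m).coeff j = (m.choose j : R) * t ^ j := by
  have h : (1 + C t * X : R[X]) ^ m = ((1 + X : R[X]) ^ m).comp (C t * X) := by simp
  rw [h, comp_C_mul_X_coeff, coeff_one_add_X_pow]

open Polynomial in
theorem coeff_one_add_C_mul_X_pow_mul_X_add_C_pow {R : Type*} [CommRing R] (t : R) (a b m : ℕ) :
    ((1 + C t * X : R[X]) ^ a * (X + C t) ^ b).coeff m
      = ∑ j ∈ Finset.range (m + 1),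
          (a.choose j : R) * t ^ j * (t ^ (b - (m - j)) * (b.choose (m - j) : R)) := by
  rw [coeff_mul, Finset.Nat.sum_antidiagonal_eq_sum_range_succ_mk]
  simp only [coeff_one_add_C_mul_X_pow, coeff_X_add_C_pow]

open Polynomial in
theorem coeff_one_sub_X_mul_one_add_X_pow_nonneg (r : ℕ) :
    0 ≤ ((1 - X : ℤ[X]) * (1 + X) ^ (2 * r)).coeff r := by
  rw [sub_mul, one_mul, coeff_sub]
  cases r with
  | zero => simp
  | succ r =>
    rw [coeff_X_mul, coeff_one_add_X_pow, coeff_one_add_X_pow, sub_nonneg]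
    exact_mod_cast Nat.choose_le_centralBinom r (r + 1)

theorem one_add_mul_pow_mul_add_pow_sub {R : Type*} [CommRing R] (t z : R) (m : ℕ) :
    (1 + t * z) ^ m * (z + t) ^ (m + 1) - (1 + t * z) ^ (m + 1) * (z + t) ^ m
      = (t - 1) * ∑ r ∈ Finset.range (m + 1),
          (m.choose r : R) * t ^ r * ((t - 1) ^ 2) ^ (m - r)
            * ((1 - z) * (1 + z) ^ (2 * r) * z ^ (m - r)) := by
  have h : (1 + t * z) * (z + t) = t * (1 + z) ^ 2 + (t - 1) ^ 2 * z := by ring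
  have h' : (1 + t * z) ^ m * (z + t) ^ m = (t * (1 + z) ^ 2 + (t - 1) ^ 2 * z) ^ m := by
    rw [← mul_pow, h]
  calc _ = (t - 1) * ((1 - z) * ((1 + t * z) ^ m * (z + t) ^ m)) := by ring
    _ = _ := by
      rw [h', add_pow, Finset.mul_sum]
      congr 1
      refine Finset.sum_congr rfl fun r _ => ?_
      rw [mul_pow, mul_pow, ← pow_mul (1 + z)]
      ring

open Polynomial in
/-- A sum of differences of binomial products, rewritten as a sum with ballot-type weights. -/
theorem sum_choose_mul_pow_sub_eq (t : ℤ[X]) (m : ℕ) :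
    ∑ j ∈ Finset.range (m + 1),
        ((m.choose j : ℤ[X]) * (((m + 1).choose (j + 1) : ℤ[X]) * t ^ (2 * j + 1)
          - ((m + 1).choose j : ℤ[X]) * t ^ (2 * j)))
      = (t - 1) * ∑ r ∈ Finset.range (m + 1),
          C (((1 - X : ℤ[X]) * (1 + X) ^ (2 * r)).coeff r)
            * ((m.choose r : ℤ[X]) * t ^ r * ((t - 1) ^ 2) ^ (m - r)) := by
  have key : (1 + C t * X : ℤ[X][X]) ^ m * (X + C t) ^ (m + 1)
        - (1 + C t * X) ^ (m + 1) * (X + C t) ^ m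
      = C (t - 1) * ∑ r ∈ Finset.range (m + 1),
          C ((m.choose r : ℤ[X]) * t ^ r * ((t - 1) ^ 2) ^ (m - r))
            * (((1 - X : ℤ[X]) * (1 + X) ^ (2 * r)).map C * X ^ (m - r)) := by
    have h := one_add_mul_pow_mul_add_pow_sub (C t : ℤ[X][X]) X m
    simpa only [Polynomial.map_mul, Polynomial.map_sub, Polynomial.map_add,
      Polynomial.map_pow, Polynomial.map_one, map_X, C_mul, C_pow, C_sub, C_1,
      map_natCast] using h
  have hm := congrArg (fun p : ℤ[X][X] => p.coeff m) key
  simp only [coeff_sub, coeff_one_add_C_mul_X_pow_mul_X_add_C_pow, coeff_C_mul,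
    finsetSum_coeff] at hm
  rw [← Finset.sum_sub_distrib] at hm
  convert hm using 1
  · refine Finset.sum_congr rfl fun j hj => ?_
    have hj : j ≤ m := Nat.lt_succ_iff.mp (Finset.mem_range.mp hj)
    have e1 : m + 1 - (m - j) = j + 1 := by omega
    have e2 : m - (m - j) = j := by omega
    have e3 : (m + 1).choose (m - j) = (m + 1).choose (j + 1) :=
      Nat.choose_symm_of_eq_add (by omega)
    rw [e1, e2, e3, Nat.choose_symm hj]
    ring
  · congr 1
    refine Finset.sum_congr rfl fun r hr => ?_
    have hr : r ≤ m := Nat.lt_succ_iff.mp (Finset.mem_range.mp hr)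
    rw [coeff_mul_X_pow', if_pos (Nat.sub_le m r), Nat.sub_sub_self hr, coeff_map]
    ring

open Polynomial in
theorem stmt18 (n : ℕ) (hn : 0 < n) (i : ℕ) (hi : i ≤ 2 * n - 1) :
    0 ≤ ∑ j ∈ Finset.Icc (i / 2) (n - 1),
        (Nat.choose (n - 1) j : ℤ)
          * ((Nat.choose n (j + 1) : ℤ) * (Nat.choose (2 * j + 1) i : ℤ)
            - (Nat.choose n j : ℤ) * (Nat.choose (2 * j) i : ℤ)) := by
  obtain ⟨m, rfl⟩ : ∃ m, n = m + 1 := ⟨n - 1, by omega⟩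
  rw [Nat.add_sub_cancel]
  have hsub : Finset.Icc (i / 2) m ⊆ Finset.range (m + 1) := fun j hj => by
    simp only [Finset.mem_Icc, Finset.mem_range] at *; omega
  rw [Finset.sum_subset hsub]
  · have h := congrArg (fun p : ℤ[X] => p.coeff i) (sum_choose_mul_pow_sub_eq (1 + X) m)
    have hl (j : ℕ) : ((m.choose j : ℤ[X]) * (((m + 1).choose (j + 1) : ℤ[X])
          * (1 + X) ^ (2 * j + 1) - ((m + 1).choose j : ℤ[X]) * (1 + X) ^ (2 * j))).coeff i
        = (m.choose j : ℤ) * (((m + 1).choose (j + 1) : ℤ) * ((2 * j + 1).choose i : ℤ)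
          - ((m + 1).choose j : ℤ) * ((2 * j).choose i : ℤ)) := by
      simp only [← C_eq_natCast, coeff_C_mul, coeff_sub, coeff_one_add_X_pow]
    simp only [finsetSum_coeff, hl] at h
    rw [h, add_sub_cancel_left, Finset.mul_sum, finsetSum_coeff]
    refine Finset.sum_nonneg fun r _ => ?_
    have e : (X : ℤ[X]) * (C (((1 - X : ℤ[X]) * (1 + X) ^ (2 * r)).coeff r)
          * ((m.choose r : ℤ[X]) * (1 + X) ^ r * (X ^ 2) ^ (m - r)))
        = C (((1 - X : ℤ[X]) * (1 + X) ^ (2 * r)).coeff r)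
          * (C (m.choose r : ℤ) * ((1 + X) ^ r * X ^ (2 * (m - r) + 1))) := by
      rw [map_natCast]; ring
    rw [e, coeff_C_mul, coeff_C_mul, coeff_mul_X_pow']
    refine mul_nonneg (coeff_one_sub_X_mul_one_add_X_pow_nonneg r)
      (mul_nonneg (Int.natCast_nonneg _) ?_)
    split_ifs
    · rw [coeff_one_add_X_pow]
      exact Int.natCast_nonneg _
    · exact le_rfl
  · intro j hj hj'
    simp only [Finset.mem_Icc, Finset.mem_range] at hj hj'
    rw [Nat.choose_eq_zero_of_lt (show 2 * j + 1 < i by omega),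
      Nat.choose_eq_zero_of_lt (show 2 * j < i by omega)]
    simp
end
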